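/- Let H=(V,E) be a finite simple graph on N vertices and h > 0 a real such that for every subset S ⊆ V with |S| ≤ N/2, the number of edges of H with exactly one endpoint in S is at least h·|S|. Let ε ∈ (0,1] and let f:V→C be any map (coloring) such that every color class satisfies |f⁻¹(c)| ≤ (1−ε)·N. Then the number of edges (u,v) ∈ E with f(u) ≠ f(v) is at least (h·ε/2)·N. -/

import Mathlib

open Finset

/-- Every edge with differently coloured ends gives at most two ordered pairs. -/
theorem ncard_bichromatic_pairs_le {V C : Type*} [Finite V] (H : SimpleGraph V) (f : V → C) :
    {p : V × V | H.Adj p.1 p.2 ∧ f p.1 ≠ f p.2}.ncard ≤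
      2 * {e : Sym2 V | e ∈ H.edgeSet ∧ ∀ u v : V, e = s(u, v) → f u ≠ f v}.ncard := by
  classical
  have := Fintype.ofFinite V
  rw [Set.ncard_eq_toFinset_card', Set.ncard_eq_toFinset_card']
  refine card_le_mul_card_image_of_maps_to (f := fun p : V × V => s(p.1, p.2)) ?_ 2 ?_
  · rintro ⟨a, b⟩ hp
    rw [Set.mem_toFinset] at hp ⊢
    refine ⟨hp.1, fun u v huv => ?_⟩
    rcases Sym2.eq_iff.mp huv with ⟨rfl, rfl⟩ | ⟨rfl, rfl⟩
    exacts [hp.2, hp.2.symm]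
  · intro e _
    induction e with | _ u v
    refine (card_le_card fun p hp => ?_).trans (card_le_two (a := (u, v)) (b := (v, u)))
    have := (mem_filter.mp hp).2
    simpa [Prod.ext_iff] using this

/-- Ordered bichromatic pairs are counted by the colour of their first entry. -/
theorem ncard_bichromatic_pairs_eq_sum {V C : Type*} [Fintype V] [DecidableEq C]
    (H : SimpleGraph V) (f : V → C) :
    {p : V × V | H.Adj p.1 p.2 ∧ f p.1 ≠ f p.2}.ncard =
      ∑ c ∈ univ.image f, {p : V × V | H.Adj p.1 p.2 ∧
        p.1 ∈ univ.filter (f · = c) ∧ p.2 ∉ univ.filter (f · = c)}.ncard := by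
  classical
  simp only [Set.ncard_eq_toFinset_card']
  rw [card_eq_sum_card_fiberwise (f := fun p : V × V => f p.1) (t := univ.image f)
    (fun p _ => by simp)]
  refine sum_congr rfl fun c _ => congrArg card ?_
  ext p
  simp only [mem_filter, Set.mem_toFinset, Set.mem_ofPred_eq, mem_univ, true_and]
  grind

/-- Expansion argument: if `H` is a graph on `N` vertices with edge expansion at least
`h` (for every `S` with `|S| ≤ N/2`, at least `h·|S|` edges leave `S`; here the number of
edges leaving `S` is counted as the number of ordered pairs `(u,v)` with `u ∈ S`, `v ∉ S`
and `u ~ v`, which counts every such edge exactly once), and `f` is a coloring in which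
every color class has at most `(1−ε)·N` vertices, then the number of bichromatic edges is
at least `(h·ε/2)·N`. -/
theorem expansion_many_bichromatic_edges {V : Type} [Fintype V] (H : SimpleGraph V)
    (N : ℕ) (hN : Fintype.card V = N) (h : ℝ) (hh : 0 < h)
    (hexp : ∀ S : Finset V, (S.card : ℝ) ≤ (N : ℝ) / 2 →
      h * (S.card : ℝ) ≤ ({p : V × V | H.Adj p.1 p.2 ∧ p.1 ∈ S ∧ p.2 ∉ S}.ncard : ℝ))
    (ε : ℝ) (hε0 : 0 < ε) (hε1 : ε ≤ 1) {C : Type} (f : V → C)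
    (hcol : ∀ c : C, ({v : V | f v = c}.ncard : ℝ) ≤ (1 - ε) * (N : ℝ)) :
    h * ε / 2 * (N : ℝ) ≤
      ({e : Sym2 V | e ∈ H.edgeSet ∧ ∀ u v : V, e = s(u, v) → f u ≠ f v}.ncard : ℝ) := by
  classical
  have hD := ncard_bichromatic_pairs_le H f
  set B := {p : V × V | H.Adj p.1 p.2 ∧ f p.1 ≠ f p.2} with hB
  set D := {e : Sym2 V | e ∈ H.edgeSet ∧ ∀ u v : V, e = s(u, v) → f u ≠ f v}
  have hD' : (B.ncard : ℝ) ≤ 2 * D.ncard := by exact_mod_cast hD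
  suffices hmain : h * (ε * N) ≤ B.ncard by linarith
  have hN0 : (0 : ℝ) ≤ N := N.cast_nonneg
  by_cases hsmall : ∀ c, (#(univ.filter (f · = c)) : ℝ) ≤ N / 2
  · calc h * (ε * N) ≤ h * N := by
          gcongr
          exact mul_le_of_le_one_left hN0 hε1
      _ = ∑ c ∈ univ.image f, h * (#(univ.filter (f · = c)) : ℝ) := by
          rw [← mul_sum, ← Nat.cast_sum, ← card_eq_sum_card_image, card_univ, hN]
      _ ≤ _ := sum_le_sum fun c _ => hexp _ (hsmall c)
      _ = B.ncard := by rw [hB, ncard_bichromatic_pairs_eq_sum, Nat.cast_sum]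
  · push Not at hsmall
    obtain ⟨c, hc⟩ := hsmall
    have hcard : (#(univ.filter (f · = c)) : ℝ) + #(univ.filter (f · ≠ c)) = N := by
      rw [← hN, ← card_univ]
      exact_mod_cast card_filter_add_card_filter_not (f · = c)
    have hcol' : (#(univ.filter (f · = c)) : ℝ) ≤ (1 - ε) * N := by
      simpa [Set.ncard_eq_toFinset_card'] using hcol c
    calc h * (ε * N) ≤ h * #(univ.filter (f · ≠ c)) := by
          gcongr
          linarith
      _ ≤ _ := hexp _ (by linarith)
      _ ≤ B.ncard := by
          refine Nat.cast_le.mpr (Set.ncard_le_ncard (fun p hp => ⟨hp.1, ?_⟩) (Set.toFinite _))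
          have := hp.2
          simp only [mem_filter, mem_univ, true_and, not_not] at this
          grind
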